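/- Let (X, dist) be a metric space, let the finite dataset D be partitioned as D = D_P ∪ (D \ D_P), let q ∈ X, and let k be a positive integer with k ≤ |D_P|. Let S be a k-nearest-neighbor set of q in the local partition D_P and let r = max_{s ∈ S} dist(q, s). If every point of D \ D_P has distance strictly greater than r from q (i.e., the closed ball of radius r around q contains no data from any other partition), then S is already a k-nearest-neighbor set of q in the entire dataset D; no second round over other partitions is needed. -/

import Mathlib

/-- `T` is a `k`-nearest-neighbor (kNN) set of `q` in the finite set `E` if
`T ⊆ E`, `|T| = k`, and every element of `T` is at least as close to `q` as
every element of `E \ T`. -/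
def IsKNN {X : Type*} [MetricSpace X] (q : X) (E : Finset X) (k : ℕ)
    (T : Finset X) : Prop :=
  T ⊆ E ∧ T.card = k ∧ ∀ o ∈ T, ∀ s ∈ E, s ∉ T → dist q o ≤ dist q s

/-- Let `(X, dist)` be a metric space, let the finite dataset
`D` be partitioned as `D = D_P ∪ (D \ D_P)`, let `q ∈ X`, and let `k` be a
positive integer with `k ≤ |D_P|`.  Let `S` be a `k`-nearest-neighbor set of
`q` in the local partition `D_P` and let `r = max_{s ∈ S} dist(q, s)`.  If
every point of `D \ D_P` has distance strictly greater than `r` from `q`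
(i.e., the closed ball of radius `r` around `q` contains no data from any
other partition), then `S` is already a `k`-nearest-neighbor set of `q` in the
entire dataset `D`; no second round over other partitions is needed. -/
theorem knn_local_partition_suffices {X : Type*} [MetricSpace X]
    (D : Finset X) (DP : Finset X) (hDP : DP ⊆ D) (q : X)
    (k : ℕ) (hk : 0 < k) (hkDP : k ≤ DP.card)
    (S : Finset X) (hS : IsKNN q DP k S)
    (hSne : S.Nonempty) (r : ℝ) (hr : r = S.sup' hSne (fun s => dist q s))
    (hfar : ∀ o ∈ D, o ∉ DP → r < dist q o) :
    IsKNN q D k S := by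
  obtain ⟨hSDP, hcard, hnear⟩ := hS
  refine ⟨hSDP.trans hDP, hcard, fun o ho s hs hsS => ?_⟩
  by_cases hsP : s ∈ DP
  · exact hnear o ho s hsP hsS
  · have hor : dist q o ≤ r := hr ▸ Finset.le_sup' (fun s => dist q s) ho
    exact hor.trans (hfar s hs hsP).le
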